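/- arXiv:1708.07975 — 4 statements merged into one kernel-verified Lean document; each statement's English description precedes it below -/
import Mathlib

section
/- In the plausible-deniability mechanism setup, let D ⊆ U be a finite dataset, d' ∈ U a record with d' ∉ D, and D' = D ∪ {d'}. Then for every synthetic record y ∈ U and every partition index i ∈ ℕ: pt(D, i, y) ≤ pt(D', i, y) ≤ exp(ε₀) · pt(D, i, y). -/
open Finset

attribute [local instance] Classical.propDecidable

noncomputable section PD

variable {U : Type*}

/-- Partition number: the unique `i : ℕ` with `γ^{-(i+1)} < x ≤ γ^{-i}` (for `0 < x ≤ 1`),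
    given by `⌊-log_γ x⌋`. -/
def Ipart (γ x : ℝ) : ℕ := ⌊-Real.logb γ x⌋₊

/-- Partition set `C_i(D, y) = {d ∈ D : p d y > 0 ∧ I_d(y) = i}`. -/
def Cpart (p : U → U → ℝ) (γ : ℝ) (D : Finset U) (y : U) (i : ℕ) : Finset U :=
  D.filter fun d => 0 < p d y ∧ Ipart γ (p d y) = i

/-- Laplace upper-tail function `Pr[L ≥ x]` for `L ~ Lap(1/ε₀)`. -/
def lapTail (ε₀ x : ℝ) : ℝ :=
  if 0 ≤ x then (1 / 2) * Real.exp (-(ε₀ * x)) else 1 - (1 / 2) * Real.exp (ε₀ * x)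

/-- Probability of passing the randomized privacy test from partition `i`. -/
def pt (p : U → U → ℝ) (γ ε₀ : ℝ) (k : ℕ) (D : Finset U) (i : ℕ) (y : U) : ℝ :=
  lapTail ε₀ ((k : ℝ) - ((Cpart p γ D y i).card : ℝ))

/-- Probability of producing `y` from partition `i`. -/
def q (p : U → U → ℝ) (γ ε₀ : ℝ) (k : ℕ) (D : Finset U) (i : ℕ) (y : U) : ℝ :=
  pt p γ ε₀ k D i y * ∑ s ∈ Cpart p γ D y i, p s y

/-- Probability that the mechanism `F` on input dataset `D` releases `y`. -/
def PF (p : U → U → ℝ) (γ ε₀ : ℝ) (k : ℕ) (D : Finset U) (y : U) : ℝ :=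
  (1 / (D.card : ℝ)) *
    ∑ s ∈ D.filter (fun s => 0 < p s y), p s y * pt p γ ε₀ k D (Ipart γ (p s y)) y

theorem lapTail_antitone {ε₀ : ℝ} (hε : 0 ≤ ε₀) : Antitone (lapTail ε₀) := by
  intro x y hxy
  have hmul : ε₀ * x ≤ ε₀ * y := mul_le_mul_of_nonneg_left hxy hε
  unfold lapTail
  split_ifs with hy hx hx
  · have : Real.exp (-(ε₀ * y)) ≤ Real.exp (-(ε₀ * x)) := Real.exp_le_exp.mpr (neg_le_neg hmul)
    linarith
  · have h₁ : Real.exp (-(ε₀ * y)) ≤ 1 :=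
      Real.exp_le_one_iff.mpr (neg_nonpos.mpr (mul_nonneg hε hy))
    have h₂ : Real.exp (ε₀ * x) ≤ 1 :=
      Real.exp_le_one_iff.mpr (mul_nonpos_of_nonneg_of_nonpos hε (not_le.mp hx).le)
    linarith
  · exact absurd (hx.trans hxy) hy
  · have : Real.exp (ε₀ * x) ≤ Real.exp (ε₀ * y) := Real.exp_le_exp.mpr hmul
    linarith

theorem lapTail_le_exp_mul_lapTail_add {ε₀ t : ℝ} (hε : 0 ≤ ε₀) (ht : 0 ≤ t) (x : ℝ) :
    lapTail ε₀ x ≤ Real.exp (ε₀ * t) * lapTail ε₀ (x + t) := by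
  have ha : 0 < Real.exp (ε₀ * x) := Real.exp_pos _
  have hE : 1 ≤ Real.exp (ε₀ * t) := Real.one_le_exp (mul_nonneg hε ht)
  unfold lapTail
  split_ifs with hx hxt hxt
  · rw [mul_left_comm, ← Real.exp_add]
    ring_nf
    exact le_rfl
  · exact absurd (add_nonneg hx ht) hxt
  · rw [mul_left_comm, ← Real.exp_add, show ε₀ * t + -(ε₀ * (x + t)) = -(ε₀ * x) by ring]
    have hinv : Real.exp (ε₀ * x) * Real.exp (-(ε₀ * x)) = 1 := by
      rw [← Real.exp_add, add_neg_cancel, Real.exp_zero]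
    have hsum : 2 ≤ Real.exp (ε₀ * x) + Real.exp (-(ε₀ * x)) := by
      nlinarith [sq_nonneg (Real.exp (ε₀ * x) - Real.exp (-(ε₀ * x))),
        Real.exp_pos (-(ε₀ * x))]
    linarith
  · have haE : Real.exp (ε₀ * x) * Real.exp (ε₀ * t) ≤ 1 := by
      rw [← Real.exp_add, ← mul_add]
      exact Real.exp_le_one_iff.mpr (mul_nonpos_of_nonneg_of_nonpos hε (not_le.mp hxt).le)
    have ha1 : Real.exp (ε₀ * x) ≤ 1 :=
      Real.exp_le_one_iff.mpr (mul_nonpos_of_nonneg_of_nonpos hε (not_le.mp hx).le)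
    rw [mul_add, Real.exp_add]
    nlinarith [mul_nonneg (sub_nonneg.mpr hE) (sub_nonneg.mpr haE),
      mul_nonneg (sub_nonneg.mpr hE) (sub_nonneg.mpr ha1)]

theorem card_Cpart_insert_le (p : U → U → ℝ) (γ : ℝ) (D : Finset U) (d' y : U) (i : ℕ) :
    (Cpart p γ (insert d' D) y i).card ≤ (Cpart p γ D y i).card + 1 := by
  unfold Cpart
  rw [Finset.filter_insert]
  split_ifs
  · exact Finset.card_insert_le _ _
  · exact Nat.le_succ _

theorem card_Cpart_mono (p : U → U → ℝ) (γ : ℝ) {D D' : Finset U} (h : D ⊆ D') (y : U) (i : ℕ) :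
    (Cpart p γ D y i).card ≤ (Cpart p γ D' y i).card :=
  Finset.card_le_card (Finset.filter_subset_filter _ h)

/-- Adding one record to the dataset can only increase the pass probability, and
by at most a multiplicative factor `e^{ε₀}`. -/
theorem pt_monotone_bound (γ ε₀ : ℝ) (hγ : 1 < γ) (hε : 0 < ε₀) (k : ℕ) (hk : 1 ≤ k)
    (p : U → U → ℝ) (hp : ∀ d y, 0 ≤ p d y ∧ p d y ≤ 1)
    (D : Finset U) (d' : U) (hd' : d' ∉ D) (D' : Finset U) (hD' : D' = insert d' D)
    (y : U) (i : ℕ) :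
    pt p γ ε₀ k D i y ≤ pt p γ ε₀ k D' i y ∧
    pt p γ ε₀ k D' i y ≤ Real.exp ε₀ * pt p γ ε₀ k D i y := by
  subst hD'
  unfold pt
  have hmono : ((Cpart p γ D y i).card : ℝ) ≤ (Cpart p γ (insert d' D) y i).card :=
    mod_cast card_Cpart_mono p γ (Finset.subset_insert d' D) y i
  have hsucc : ((Cpart p γ (insert d' D) y i).card : ℝ) ≤ (Cpart p γ D y i).card + 1 :=
    mod_cast card_Cpart_insert_le p γ D d' y i
  refine ⟨lapTail_antitone hε.le (by linarith), ?_⟩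
  have hshift := lapTail_le_exp_mul_lapTail_add hε.le zero_le_one
    ((k : ℝ) - (Cpart p γ (insert d' D) y i).card)
  rw [mul_one] at hshift
  exact hshift.trans
    (mul_le_mul_of_nonneg_left (lapTail_antitone hε.le (by linarith)) (Real.exp_pos _).le)

end PD
end

section
/- In the plausible-deniability mechanism setup, let t be an integer with 1 ≤ t < k. Let D ⊆ U be a finite dataset, d' ∈ U with d' ∉ D and p d' y > 0, and D' = D ∪ {d'}; let j = I_{d'}(y). If |C_j(D, y)| < t, then: q(D, j, y) < q(D', j, y), and q(D', j, y) ≤ exp(-ε₀·(k - t)) · Σ_{s ∈ C_j(D',y)} p s y ≤ t · exp(-ε₀·(k - t)). -/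
open Finset

attribute [local instance] Classical.propDecidable

noncomputable section PD

variable {U : Type*}

theorem Cpart_insert (p : U → U → ℝ) {γ : ℝ} (D : Finset U) {d y : U} (hpos : 0 < p d y) :
    Cpart p γ (insert d D) y (Ipart γ (p d y)) =
      insert d (Cpart p γ D y (Ipart γ (p d y))) := by
  rw [Cpart, Finset.filter_insert, if_pos ⟨hpos, rfl⟩, Cpart]

theorem lapTail_of_nonneg {ε₀ x : ℝ} (hx : 0 ≤ x) :
    lapTail ε₀ x = (1 / 2) * Real.exp (-(ε₀ * x)) :=
  if_pos hx

/-- If the partition `j = I_{d'}(y)` of the added record contains fewer than `t` records,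
then `q(D, j, y) < q(D', j, y)` and
`q(D', j, y) ≤ e^{-ε₀(k-t)} · Σ_{s ∈ C_j(D',y)} p s y ≤ t · e^{-ε₀(k-t)}`. -/
theorem q_added_partition_small (γ ε₀ : ℝ) (hγ : 1 < γ) (hε : 0 < ε₀)
    (k : ℕ) (hk : 1 ≤ k) (t : ℕ) (ht : 1 ≤ t) (htk : t < k)
    (p : U → U → ℝ) (hp : ∀ d y, 0 ≤ p d y ∧ p d y ≤ 1)
    (D : Finset U) (d' : U) (hd' : d' ∉ D) (D' : Finset U) (hD' : D' = insert d' D)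
    (y : U) (hpos : 0 < p d' y) (j : ℕ) (hj : j = Ipart γ (p d' y))
    (hsmall : (Cpart p γ D y j).card < t) :
    q p γ ε₀ k D j y < q p γ ε₀ k D' j y ∧
    q p γ ε₀ k D' j y ≤ Real.exp (-(ε₀ * ((k : ℝ) - t))) * ∑ s ∈ Cpart p γ D' y j, p s y ∧
    Real.exp (-(ε₀ * ((k : ℝ) - t))) * ∑ s ∈ Cpart p γ D' y j, p s y ≤
      (t : ℝ) * Real.exp (-(ε₀ * ((k : ℝ) - t))) := by
  subst hj hD'
  have hnot : d' ∉ Cpart p γ D y (Ipart γ (p d' y)) := fun h => hd' (Finset.mem_filter.1 h).1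
  simp only [q, pt, Cpart_insert p D hpos, Finset.card_insert_of_notMem hnot,
    Finset.sum_insert hnot]
  generalize Cpart p γ D y (Ipart γ (p d' y)) = C at hsmall
  have hct : (C.card : ℝ) + 1 ≤ t := by exact_mod_cast hsmall
  have htk' : (t : ℝ) < k := by exact_mod_cast htk
  have hS : 0 ≤ ∑ s ∈ C, p s y := Finset.sum_nonneg fun s _ => (hp s y).1
  have hSc : ∑ s ∈ C, p s y ≤ C.card := by
    simpa using Finset.sum_le_card_nsmul C (fun s => p s y) 1 fun s _ => (hp s y).2
  push_cast
  rw [lapTail_of_nonneg (by linarith), lapTail_of_nonneg (by linarith)]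
  refine ⟨?_, ?_, ?_⟩
  · refine mul_lt_mul'' ?_ (by linarith) (by positivity) hS
    gcongr
    linarith
  · refine mul_le_mul_of_nonneg_right ?_ (by linarith)
    have hexp : Real.exp (-(ε₀ * ((k : ℝ) - (C.card + 1)))) ≤ Real.exp (-(ε₀ * ((k : ℝ) - t))) := by
      gcongr
    have := Real.exp_pos (-(ε₀ * ((k : ℝ) - (C.card + 1))))
    linarith
  · rw [mul_comm]
    refine mul_le_mul_of_nonneg_right ?_ (Real.exp_pos _).le
    linarith [(hp d' y).2]

end PD
end

section
/- In the plausible-deniability mechanism setup, let D ⊆ U be a finite dataset, d' ∈ U with d' ∉ D, and D' = D ∪ {d'}. Then for every synthetic record y ∈ U and every partition index i ∈ ℕ: q(D, i, y) ≤ q(D', i, y). -/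
open Finset

attribute [local instance] Classical.propDecidable

noncomputable section PD

variable {U : Type*}

theorem lapTail_nonneg {ε₀ : ℝ} (hε : 0 ≤ ε₀) (x : ℝ) : 0 ≤ lapTail ε₀ x := by
  unfold lapTail
  split_ifs with hx
  · positivity
  · have : Real.exp (ε₀ * x) ≤ 1 :=
      Real.exp_le_one_iff.2 (mul_nonpos_of_nonneg_of_nonpos hε (not_le.1 hx).le)
    linarith

theorem Cpart_mono (p : U → U → ℝ) (γ : ℝ) {D D' : Finset U} (h : D ⊆ D') (y : U) (i : ℕ) :
    Cpart p γ D y i ⊆ Cpart p γ D' y i :=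
  filter_subset_filter _ h

theorem pt_mono (p : U → U → ℝ) (γ : ℝ) {ε₀ : ℝ} (hε : 0 ≤ ε₀) (k : ℕ) {D D' : Finset U}
    (h : D ⊆ D') (i : ℕ) (y : U) : pt p γ ε₀ k D i y ≤ pt p γ ε₀ k D' i y := by
  have hcard : ((Cpart p γ D y i).card : ℝ) ≤ (Cpart p γ D' y i).card :=
    Nat.cast_le.2 (card_le_card (Cpart_mono p γ h y i))
  exact lapTail_antitone hε (by linarith)

/-- Adding a record to the dataset can only increase `q(·, i, y)`, for every partition `i`. -/
theorem q_monotone (γ ε₀ : ℝ) (hγ : 1 < γ) (hε : 0 < ε₀) (k : ℕ) (hk : 1 ≤ k)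
    (p : U → U → ℝ) (hp : ∀ d y, 0 ≤ p d y ∧ p d y ≤ 1)
    (D : Finset U) (d' : U) (hd' : d' ∉ D) (D' : Finset U) (hD' : D' = insert d' D)
    (y : U) (i : ℕ) :
    q p γ ε₀ k D i y ≤ q p γ ε₀ k D' i y := by
  have hD : D ⊆ D' := hD' ▸ subset_insert d' D
  exact mul_le_mul (pt_mono p γ hε.le k hD i y)
    (sum_le_sum_of_subset_of_nonneg (Cpart_mono p γ hD y i) fun s _ _ => (hp s y).1)
    (sum_nonneg fun s _ => (hp s y).1) (lapTail_nonneg hε.le _)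

end PD
end

section
/- (Sensitivity of entropy.) Let m ≥ 1 and n ≥ 1 be integers, and let c, c' : Fin m → ℕ be two histograms with Σ_i c_i = Σ_i c'_i = n, such that there exist indices j₁ ≠ j₂ with c'_{j₁} = c_{j₁} + 1, c'_{j₂} = c_{j₂} - 1 (so c_{j₂} ≥ 1), and c'_i = c_i for all i ∉ {j₁, j₂}. Then |H(c) - H(c')| ≤ (1/n) · (2 + 1/ln(2) + 2·log₂(n)). -/
/-- Base-2 Shannon entropy of the empirical distribution of a histogram `c` with total
count `n`. Terms with `c i = 0` contribute `0` (since `Real.logb 2 0 = 0`). -/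
noncomputable def histEntropy {m : ℕ} (n : ℕ) (c : Fin m → ℕ) : ℝ :=
  -∑ i : Fin m, ((c i : ℝ) / (n : ℝ)) * Real.logb 2 ((c i : ℝ) / (n : ℝ))

/-- The increments of `k ↦ k log k` over the natural numbers are nonnegative. -/
theorem natCast_mul_log_le_succ (k : ℕ) :
    (k : ℝ) * Real.log k ≤ ((k : ℝ) + 1) * Real.log ((k : ℝ) + 1) := by
  rcases Nat.eq_zero_or_pos k with rfl | hk
  · simp
  · have hk1 : (1 : ℝ) ≤ k := by exact_mod_cast hk
    have := Real.log_nonneg hk1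
    gcongr <;> linarith

/-- The increments of `k ↦ k log k` over the natural numbers are at most `1 + log (k + 1)`. -/
theorem natCast_succ_mul_log_le (k : ℕ) :
    ((k : ℝ) + 1) * Real.log ((k : ℝ) + 1) ≤
      (k : ℝ) * Real.log k + (1 + Real.log ((k : ℝ) + 1)) := by
  rcases Nat.eq_zero_or_pos k with rfl | hk
  · simp
  · have hk0 : (0 : ℝ) < k := by exact_mod_cast hk
    have h := Real.log_le_sub_one_of_pos (x := ((k : ℝ) + 1) / k) (by positivity)
    rw [Real.log_div (by positivity) hk0.ne'] at h
    have h' := mul_le_mul_of_nonneg_left h hk0.le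
    have : (k : ℝ) * (((k : ℝ) + 1) / k - 1) = 1 := by field_simp; ring
    linarith

/-- Separation of the normalisation in an entropy summand, valid also for `k = 0`. -/
theorem div_mul_logb_div (k n : ℕ) (hn : 1 ≤ n) :
    ((k : ℝ) / n) * Real.logb 2 ((k : ℝ) / n) =
      (1 / (n * Real.log 2)) * ((k : ℝ) * Real.log k - k * Real.log n) := by
  rcases Nat.eq_zero_or_pos k with rfl | hk
  · simp
  · have hk0 : (k : ℝ) ≠ 0 := by positivity
    have hn0 : (n : ℝ) ≠ 0 := by positivity
    rw [Real.logb, Real.log_div hk0 hn0]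
    have := (Real.log_pos one_lt_two).ne'
    field_simp

/-- Sensitivity of the entropy: if histograms `c` and `c'` (both of total count `n`) differ
by moving one record from bin `j₂` to bin `j₁`, then
`|H(c) - H(c')| ≤ (1/n)(2 + 1/ln 2 + 2·log₂ n)`. -/
theorem entropy_sensitivity (m n : ℕ) (hm : 1 ≤ m) (hn : 1 ≤ n)
    (c c' : Fin m → ℕ) (hc : ∑ i, c i = n) (hc' : ∑ i, c' i = n)
    (j₁ j₂ : Fin m) (hj : j₁ ≠ j₂)
    (h1 : c' j₁ = c j₁ + 1) (hpos : 1 ≤ c j₂) (h2 : c' j₂ = c j₂ - 1)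
    (hother : ∀ i : Fin m, i ≠ j₁ → i ≠ j₂ → c' i = c i) :
    |histEntropy n c - histEntropy n c'| ≤
      (1 / (n : ℝ)) * (2 + 1 / Real.log 2 + 2 * Real.logb 2 (n : ℝ)) := by
  have ha : c j₁ + 1 ≤ n := by
    rw [← h1, ← hc']
    exact Finset.single_le_sum (fun _ _ => Nat.zero_le _) (Finset.mem_univ j₁)
  have hb : c j₂ ≤ n := by
    rw [← hc]
    exact Finset.single_le_sum (fun _ _ => Nat.zero_le _) (Finset.mem_univ j₂)
  obtain ⟨b, hb'⟩ : ∃ b, c j₂ = b + 1 := ⟨c j₂ - 1, by omega⟩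
  have h2' : c' j₂ = b := by omega
  rw [hb'] at hb
  have hn1 : (1 : ℝ) ≤ n := by exact_mod_cast hn
  have hl2 := Real.log_pos one_lt_two
  have hlog := Real.log_nonneg hn1
  have hdiff : histEntropy n c - histEntropy n c' =
      (1 / (n * Real.log 2)) *
        ((((c j₁ : ℝ) + 1) * Real.log ((c j₁ : ℝ) + 1) - c j₁ * Real.log (c j₁)) -
          (((b : ℝ) + 1) * Real.log ((b : ℝ) + 1) - b * Real.log b)) := by
    simp only [histEntropy, div_mul_logb_div _ n hn]
    rw [neg_sub_neg, ← Finset.sum_sub_distrib, Fintype.sum_eq_add j₁ j₂ hj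
      (fun i hi => by rw [hother i hi.1 hi.2, sub_self]), h1, h2', hb']
    push_cast
    ring
  have hlog_le : ∀ k : ℕ, k + 1 ≤ n → Real.log ((k : ℝ) + 1) ≤ Real.log n := fun k hk =>
    Real.log_le_log (by positivity) (by exact_mod_cast hk)
  have hbound : (1 / (n : ℝ)) * (2 + 1 / Real.log 2 + 2 * Real.logb 2 (n : ℝ)) =
      (1 / (n * Real.log 2)) * (2 * Real.log 2 + 1 + 2 * Real.log n) := by
    rw [Real.logb]
    field_simp
  rw [hdiff, hbound, abs_mul, abs_of_pos (by positivity)]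
  gcongr
  rw [abs_le]
  have := natCast_mul_log_le_succ (c j₁)
  have := natCast_mul_log_le_succ b
  have := natCast_succ_mul_log_le (c j₁)
  have := natCast_succ_mul_log_le b
  have := hlog_le _ ha
  have := hlog_le _ hb
  constructor <;> linarith
end
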